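/- Let V be a finite-dimensional complex vector space and r ≥ 1. Then the commutant of the 𝔖_r-action on V^{⊗ r}, namely { f ∈ End_ℂ(V^{⊗ r}) : f ∘ P_σ = P_σ ∘ f for all σ ∈ 𝔖_r }, is equal to the ℂ-linear span of { g^{⊗ r} : g ∈ GL(V) }. (Schur–Weyl duality, second half: the image of U(𝔤𝔩(V)) is all of End_{𝔖_r}(V^{⊗ r}).) -/

import Mathlib

open Module LinearMap Finset

open scoped TensorProduct

/-- The permutation operator `P_σ : v_1 ⊗ ⋯ ⊗ v_r ↦ v_{σ⁻¹(1)} ⊗ ⋯ ⊗ v_{σ⁻¹(r)}`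
on the `r`-th tensor power of `V`. -/
noncomputable def permOp (V : Type*) [AddCommGroup V] [Module ℂ V] (r : ℕ)
    (σ : Equiv.Perm (Fin r)) :
    Module.End ℂ (⨂[ℂ] _ : Fin r, V) :=
  (PiTensorProduct.reindex ℂ (fun _ : Fin r => V) σ).toLinearMap

/-- The diagonal operator `g^{⊗ r} : v_1 ⊗ ⋯ ⊗ v_r ↦ g v_1 ⊗ ⋯ ⊗ g v_r`. -/
noncomputable def tensorPow (V : Type*) [AddCommGroup V] [Module ℂ V] (r : ℕ)
    (g : V ≃ₗ[ℂ] V) :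
    Module.End ℂ (⨂[ℂ] _ : Fin r, V) :=
  PiTensorProduct.map fun _ : Fin r => (g : V →ₗ[ℂ] V)

/-- The alternating count of the subsets containing the range of `p` detects surjectivity of `p`. -/
theorem sum_neg_one_pow_range_subset {ι κ : Type*} [Fintype ι] [Fintype κ] [DecidableEq κ]
    (p : ι → κ) [Decidable (Function.Surjective p)] :
    ∑ S : Finset κ, (if ∀ i, p i ∈ S then (-1 : ℤ) ^ #Sᶜ else 0) =
      if Function.Surjective p then 1 else 0 := by
  classical
  have h := Fintype.prod_add (fun _ : κ => (1 : ℤ))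
    (fun a => if ∃ i, p i = a then 0 else -1)
  have hl : ∏ a : κ, ((1 : ℤ) + if ∃ i, p i = a then 0 else -1) =
      if Function.Surjective p then 1 else 0 := by
    split_ifs with hp
    · exact Finset.prod_eq_one fun a _ => by simp [hp a]
    · obtain ⟨a, ha⟩ := not_forall.mp hp
      exact Finset.prod_eq_zero (Finset.mem_univ a) (by simp [ha])
  rw [← hl, h]
  refine Finset.sum_congr rfl fun S _ => ?_
  simp only [Finset.prod_const_one, one_mul]
  split_ifs with hS
  · rw [Finset.prod_congr rfl (g := fun _ => (-1 : ℤ)), Finset.prod_const]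
    intro a ha
    rw [if_neg]
    rintro ⟨i, rfl⟩
    exact Finset.mem_compl.mp ha (hS i)
  · obtain ⟨i, hi⟩ := not_forall.mp hS
    exact (Finset.prod_eq_zero (Finset.mem_compl.mpr hi) (by simp)).symm

/-- Polarization: the symmetrization of a multilinear map is an alternating sum of its values on
the diagonal. -/
theorem MultilinearMap.sum_perm_eq_sum_diagonal {R ι E F : Type*} [CommRing R] [Fintype ι]
    [DecidableEq ι] [AddCommGroup E] [Module R E] [AddCommGroup F] [Module R F]
    (M : MultilinearMap R (fun _ : ι => E) F) (x : ι → E) :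
    ∑ σ : Equiv.Perm ι, M (fun i => x (σ i)) =
      ∑ S : Finset ι, (-1 : ℤ) ^ #Sᶜ • M (fun _ => ∑ j ∈ S, x j) := by
  classical
  have hM (S : Finset ι) : M (fun _ => ∑ j ∈ S, x j) =
      ∑ p : ι → ι, if ∀ i, p i ∈ S then M (fun i => x (p i)) else 0 := by
    rw [M.map_sum_finset (fun _ => x) (fun _ => S), ← Finset.sum_filter]
    congr 1
    ext p
    simp
  simp_rw [hM, Finset.smul_sum]
  rw [Finset.sum_comm]
  have hp (p : ι → ι) : ∑ S : Finset ι,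
      (-1 : ℤ) ^ #Sᶜ • (if ∀ i, p i ∈ S then M (fun i => x (p i)) else 0) =
      if Function.Surjective p then M (fun i => x (p i)) else 0 := by
    have h := congrArg (· • M (fun i => x (p i))) (sum_neg_one_pow_range_subset p)
    simpa [Finset.sum_smul, ite_smul, smul_ite] using h
  simp_rw [hp, ← Finset.sum_filter]
  refine Finset.sum_bij (fun σ _ => ⇑σ) (by simp [Equiv.surjective])
    (fun σ _ τ _ h => DFunLike.coe_injective h) (fun p hp => ?_) (fun _ _ => rfl)
  have hs : Function.Surjective p := by simpa using hp
  exact ⟨Equiv.ofBijective p (Finite.surjective_iff_bijective.mp hs), Finset.mem_univ _, rfl⟩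

/-- Along a line in direction `y`, a subspace containing infinitely many diagonal values of a
multilinear map contains all of them; here, the one at `x`. -/
theorem MultilinearMap.diagonal_mem_of_infinite {K ι E F : Type*} [Field K] [Finite ι]
    [AddCommGroup E] [Module K E] [AddCommGroup F] [Module K F]
    (M : MultilinearMap K (fun _ : ι => E) F) (W : Submodule K F) (x y : E)
    (h : {t : K | M (fun _ => t • y + x) ∈ W}.Infinite) : M (fun _ => x) ∈ W := by
  classical
  have := Fintype.ofFinite ι
  by_contra hx
  obtain ⟨l, hl, hW⟩ := Submodule.exists_le_ker_of_notMem hx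
  let q : Polynomial K := ∑ S : Finset ι,
    Polynomial.C (l (M (S.piecewise (fun _ => y) fun _ => x))) * Polynomial.X ^ #S
  have hq (t : K) : q.eval t = l (M (fun _ => t • y + x)) := by
    have hadd := M.map_add_univ (fun _ => t • y) (fun _ => x)
    rw [show (fun _ : ι => t • y + x) = (fun _ => t • y) + fun _ => x from rfl, hadd,
      _root_.map_sum, Polynomial.eval_finsetSum]
    refine Finset.sum_congr rfl fun S _ => ?_
    have hs := M.map_piecewise_smul (fun _ => t) (S.piecewise (fun _ => y) fun _ => x) S
    rw [Finset.prod_const] at hs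
    have he : S.piecewise (fun i => t • S.piecewise (fun _ => y) (fun _ => x) i)
        (S.piecewise (fun _ => y) fun _ => x) = S.piecewise (fun _ => t • y) fun _ => x := by
      ext i
      by_cases hi : i ∈ S <;> simp [hi]
    rw [he] at hs
    rw [hs, map_smul, smul_eq_mul, Polynomial.eval_mul, Polynomial.eval_C, Polynomial.eval_pow,
      Polynomial.eval_X, mul_comm]
  have hq0 : q = 0 := Polynomial.eq_zero_of_infinite_isRoot q <| h.mono fun t ht => by
    simpa [Polynomial.IsRoot, hq] using hW ht
  apply hl
  simpa [hq0] using (hq 0).symm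

/-- The operators `⨂ᵢ φᵢ` span the endomorphisms of a tensor product of finite free modules. -/
theorem PiTensorProduct.span_range_map_eq_top {R ι : Type*} {V : ι → Type*} [CommRing R]
    [Finite ι] [∀ i, AddCommGroup (V i)] [∀ i, Module R (V i)] [∀ i, Module.Free R (V i)]
    [∀ i, Module.Finite R (V i)] :
    Submodule.span R (Set.range fun φ : ∀ i, Module.End R (V i) => PiTensorProduct.map φ) = ⊤ := by
  classical
  have := Fintype.ofFinite ι
  refine eq_top_iff.mpr fun f _ => ?_
  let b (i : ι) := Module.Free.chooseBasis R (V i)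
  let B := Basis.piTensorProduct b
  have hf : f = ∑ p, ∑ q, B.repr (f (B p)) q •
      PiTensorProduct.map fun i => ((b i).coord (p i)).smulRight (b i (q i)) := by
    refine B.ext fun p => ?_
    have hm (p' q : ∀ i, Module.Free.ChooseBasisIndex R (V i)) :
        PiTensorProduct.map (fun i => ((b i).coord (p' i)).smulRight (b i (q i))) (B p) =
          if p' = p then B q else 0 := by
      simp only [B, Basis.piTensorProduct_apply, PiTensorProduct.map_tprod,
        LinearMap.smulRight_apply, MultilinearMap.map_smul_univ, Basis.coord_apply,
        Basis.repr_self, Finsupp.single_apply, Fintype.prod_ite_zero, ← funext_iff, eq_comm]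
      simp
    simp only [LinearMap.sum_apply, LinearMap.smul_apply, hm, smul_ite, smul_zero]
    rw [Finset.sum_comm]
    simp [B.sum_repr]
  rw [hf]
  exact Submodule.sum_mem _ fun p _ => Submodule.sum_mem _ fun q _ =>
    Submodule.smul_mem _ _ (Submodule.subset_span ⟨_, rfl⟩)

/-- Every diagonal operator `A^{⊗ r}` lies in the span of those with `A` invertible. -/
theorem map_const_mem_span_tensorPow {V : Type*} [AddCommGroup V] [Module ℂ V]
    [FiniteDimensional ℂ V] (r : ℕ) (A : Module.End ℂ V) :
    PiTensorProduct.map (fun _ : Fin r => A) ∈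
      Submodule.span ℂ {f | ∃ g : V ≃ₗ[ℂ] V, f = tensorPow V r g} := by
  refine (PiTensorProduct.mapMultilinear ℂ (fun _ : Fin r => V)
    fun _ => V).diagonal_mem_of_infinite _ A 1 ?_
  refine (Module.End.finite_spectrum (-A)).infinite_compl.mono fun t ht => ?_
  have hu : IsUnit (t • (1 : Module.End ℂ V) + A) := by
    simpa [spectrum.mem_iff, Algebra.algebraMap_eq_smul_one] using ht
  obtain ⟨u, hu⟩ := hu
  refine Submodule.subset_span ⟨LinearMap.GeneralLinearGroup.toLinearEquiv u, ?_⟩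
  rw [tensorPow, ← hu]
  rfl

theorem permOp_comp_map {V : Type*} [AddCommGroup V] [Module ℂ V] {r : ℕ}
    (σ : Equiv.Perm (Fin r)) (φ : Fin r → Module.End ℂ V) :
    permOp V r σ ∘ₗ PiTensorProduct.map φ =
      PiTensorProduct.map (fun i => φ (σ.symm i)) ∘ₗ permOp V r σ :=
  (PiTensorProduct.map_comp_reindex_eq φ σ).symm

theorem permOp_comp_permOp_symm {V : Type*} [AddCommGroup V] [Module ℂ V] {r : ℕ}
    (σ : Equiv.Perm (Fin r)) : permOp V r σ ∘ₗ permOp V r σ.symm = LinearMap.id := by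
  ext x
  simp [permOp]

/-- The symmetrization `∑_σ P_σ f P_σ⁻¹` of any operator `f` lies in the span of the `g^{⊗ r}`. -/
theorem sum_conj_permOp_mem_span_tensorPow {V : Type*} [AddCommGroup V] [Module ℂ V]
    [FiniteDimensional ℂ V] (r : ℕ) (f : Module.End ℂ (⨂[ℂ] _ : Fin r, V)) :
    ∑ σ : Equiv.Perm (Fin r), permOp V r σ ∘ₗ f ∘ₗ permOp V r σ.symm ∈
      Submodule.span ℂ {f | ∃ g : V ≃ₗ[ℂ] V, f = tensorPow V r g} := by
  have hf : f ∈ Submodule.span ℂ (Set.range fun φ : Fin r → Module.End ℂ V =>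
      PiTensorProduct.map φ) := by
    rw [PiTensorProduct.span_range_map_eq_top]
    trivial
  induction hf using Submodule.span_induction with
  | mem f hf =>
    obtain ⟨φ, rfl⟩ := hf
    simp_rw [← LinearMap.comp_assoc, permOp_comp_map, LinearMap.comp_assoc,
      permOp_comp_permOp_symm, LinearMap.comp_id]
    have h := (PiTensorProduct.mapMultilinear ℂ (fun _ : Fin r => V)
      fun _ => V).sum_perm_eq_sum_diagonal φ
    simp only [PiTensorProduct.mapMultilinear_apply] at h
    rw [← Equiv.sum_comp (Equiv.inv (Equiv.Perm (Fin r)))] at h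
    have h' : ∑ σ : Equiv.Perm (Fin r), PiTensorProduct.map (fun i => φ (σ.symm i)) = _ := h
    rw [h']
    exact Submodule.sum_mem _ fun S _ => zsmul_mem (map_const_mem_span_tensorPow r _) _
  | zero => simp
  | add f g _ _ hf hg =>
    simpa [LinearMap.add_comp, LinearMap.comp_add, Finset.sum_add_distrib] using add_mem hf hg
  | smul c f _ hf =>
    simpa [LinearMap.smul_comp, LinearMap.comp_smul, Finset.smul_sum] using
      Submodule.smul_mem _ c hf

/-- Schur–Weyl duality, second half: the commutant of the `𝔖_r`-action on
`V^{⊗r}` is the linear span of the operators `g^{⊗r}` for `g ∈ GL(V)`. -/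
theorem schur_weyl_duality_second_half
    (V : Type*) [AddCommGroup V] [Module ℂ V] [FiniteDimensional ℂ V]
    (r : ℕ) (hr : 1 ≤ r) :
    (Submodule.span ℂ
        {f : Module.End ℂ (⨂[ℂ] _ : Fin r, V) |
          ∃ g : V ≃ₗ[ℂ] V, f = tensorPow V r g} :
        Set (Module.End ℂ (⨂[ℂ] _ : Fin r, V)))
      = {f : Module.End ℂ (⨂[ℂ] _ : Fin r, V) |
          ∀ σ : Equiv.Perm (Fin r), f ∘ₗ permOp V r σ = permOp V r σ ∘ₗ f} := by
  refine Set.Subset.antisymm (fun f hf σ => ?_) fun f hf => ?_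
  · induction hf using Submodule.span_induction with
    | mem f hf =>
      obtain ⟨g, rfl⟩ := hf
      exact (permOp_comp_map σ fun _ => (g : V →ₗ[ℂ] V)).symm
    | zero => rw [LinearMap.zero_comp, LinearMap.comp_zero]
    | add f g _ _ hf hg => rw [LinearMap.add_comp, LinearMap.comp_add, hf, hg]
    | smul c f _ hf => rw [LinearMap.smul_comp, LinearMap.comp_smul, hf]
  · have h := sum_conj_permOp_mem_span_tensorPow r f
    have hc (σ : Equiv.Perm (Fin r)) : permOp V r σ ∘ₗ f ∘ₗ permOp V r σ.symm = f := by
      rw [← LinearMap.comp_assoc, ← hf σ, LinearMap.comp_assoc, permOp_comp_permOp_symm,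
        LinearMap.comp_id]
    simp_rw [hc, Finset.sum_const, ← Nat.cast_smul_eq_nsmul ℂ] at h
    exact (Submodule.smul_mem_iff _ (by simp [Fintype.card_ne_zero])).mp h
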